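/- arXiv:1212.6090 — 2 statements merged into one kernel-verified Lean document; each statement's English description precedes it below -/
import Mathlib

section
/- Let 0 < β ≤ 1 and suppose there is a constant C with p_n ≤ C·2^{−nβ} for all n. Then almost surely the Hausdorff dimension of the limsup fractal D is at most 1 − β. -/
open MeasureTheory ProbabilityTheory Filter Set

open scoped ENNReal Topology

/-- If the total `d`-dimensional content of the selected dyadic intervals is finite, then the
set of points lying in infinitely many selected intervals is `μH[d]`-null. -/
lemma hausdorffMeasure_dyadic_limsup_eq_zero (P : ℕ → ℕ → Prop) [∀ n i, Decidable (P n i)]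
    {d : ℝ} (hd : 0 < d)
    (h : ∑' n : ℕ, ∑ i : Fin (2 ^ n),
      (if P n i then ENNReal.ofReal ((2 ^ n)⁻¹) ^ d else 0) ≠ ∞) :
    μH[d] {θ : ℝ | θ ∈ Set.Ico (0 : ℝ) 1 ∧ ∃ᶠ n : ℕ in atTop, P n ⌊2 ^ n * θ⌋₊} = 0 := by
  set t : (N : ℕ) → (Σ k : ℕ, Fin (2 ^ (k + N))) → Set ℝ := fun N x =>
    if P (x.1 + N) x.2 then
      Icc ((x.2 : ℝ) / 2 ^ (x.1 + N)) (((x.2 : ℝ) + 1) / 2 ^ (x.1 + N)) else ∅ with ht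
  have hdiam : ∀ N x, Metric.ediam (t N x) ≤
      if P (x.1 + N) x.2 then ENNReal.ofReal ((2 ^ (x.1 + N))⁻¹) else 0 := by
    intro N x
    simp only [ht]
    split_ifs with hP
    · rw [Real.ediam_Icc]
      apply ENNReal.ofReal_le_ofReal
      apply le_of_eq
      ring
    · simp
  have hr : Tendsto (fun N : ℕ => ENNReal.ofReal ((2 ^ N)⁻¹)) atTop (𝓝 0) := by
    have := tendsto_inv_atTop_zero.comp
      (tendsto_pow_atTop_atTop_of_one_lt (one_lt_two : (1 : ℝ) < 2))
    simpa using ENNReal.tendsto_ofReal this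
  have key := Measure.hausdorffMeasure_le_liminf_tsum (l := atTop) d
    {θ : ℝ | θ ∈ Set.Ico (0 : ℝ) 1 ∧ ∃ᶠ n : ℕ in atTop, P n ⌊2 ^ n * θ⌋₊}
    (fun N : ℕ => ENNReal.ofReal ((2 ^ N)⁻¹)) hr t
    (Eventually.of_forall fun N x => by
      refine (hdiam N x).trans ?_
      split_ifs
      · apply ENNReal.ofReal_le_ofReal
        gcongr
        · norm_num
        · omega
      · simp)
    (Eventually.of_forall fun N θ hθ => by
      obtain ⟨⟨h0, h1⟩, hf⟩ := hθ
      obtain ⟨n, hn, hP⟩ := frequently_atTop.1 hf N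
      obtain ⟨k, rfl⟩ := Nat.exists_eq_add_of_le' hn
      have hpos : (0 : ℝ) < 2 ^ (k + N) := by positivity
      have hlt : ⌊2 ^ (k + N) * θ⌋₊ < 2 ^ (k + N) := by
        rw [Nat.floor_lt (by positivity)]
        push_cast
        nlinarith
      refine mem_iUnion.2 ⟨⟨k, ⟨_, hlt⟩⟩, ?_⟩
      simp only [ht, if_pos hP]
      constructor
      · rw [div_le_iff₀ hpos, mul_comm θ]
        exact Nat.floor_le (by positivity)
      · rw [le_div_iff₀ hpos, mul_comm θ]
        exact (Nat.lt_floor_add_one _).le)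
  refine le_antisymm (key.trans ?_) zero_le
  have htail := ENNReal.tendsto_sum_nat_add _ h
  rw [← htail.liminf_eq]
  refine liminf_le_liminf (Eventually.of_forall fun N => ?_)
  rw [ENNReal.tsum_sigma']
  refine ENNReal.tsum_le_tsum fun k => ?_
  rw [tsum_fintype]
  refine Finset.sum_le_sum fun i _ => ?_
  refine (ENNReal.rpow_le_rpow (hdiam N ⟨k, i⟩) hd.le).trans ?_
  dsimp only
  split_ifs
  · rfl
  · rw [ENNReal.zero_rpow_of_pos hd]

open Classical in
/-- A first-moment bound: under `P(A n i) ≤ C 2^{-nβ}`, the expected `d`-dimensional content of the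
selected dyadic intervals is finite for `d > 1 - β`, hence the content is almost surely finite. -/
lemma ae_dyadic_content_ne_top {Ω : Type*} {mΩ : MeasurableSpace Ω} (μ : Measure Ω)
    (A : ℕ → ℕ → Set Ω) (hA : ∀ n i, MeasurableSet (A n i)) {β C d : ℝ} (hd : 1 - β < d)
    (hC : ∀ n i, i < 2 ^ n → μ (A n i) ≤ ENNReal.ofReal (C * 2 ^ (-(n : ℝ) * β))) :
    ∀ᵐ ω ∂μ, ∑' n : ℕ, ∑ i : Fin (2 ^ n),
      (if ω ∈ A n i then ENNReal.ofReal ((2 ^ n)⁻¹) ^ d else 0) ≠ ∞ := by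
  have hmeas : ∀ n : ℕ, ∀ i : Fin (2 ^ n), Measurable fun ω =>
      (if ω ∈ A n i then ENNReal.ofReal ((2 ^ n)⁻¹) ^ d else 0) := fun n i =>
    Measurable.ite (hA n i) measurable_const measurable_const
  have hsum : ∀ n : ℕ, Measurable fun ω => ∑ i : Fin (2 ^ n),
      (if ω ∈ A n i then ENNReal.ofReal ((2 ^ n)⁻¹) ^ d else 0) := fun n =>
    Finset.measurable_fun_sum _ fun i _ => hmeas n i
  have hfin : ∫⁻ ω, ∑' n : ℕ, ∑ i : Fin (2 ^ n),
      (if ω ∈ A n i then ENNReal.ofReal ((2 ^ n)⁻¹) ^ d else 0) ∂μ ≠ ∞ := by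
    rw [lintegral_tsum fun n => (hsum n).aemeasurable]
    have hr0 : (0 : ℝ) ≤ 2 ^ (1 - β - d) := by positivity
    have hr1 : (2 : ℝ) ^ (1 - β - d) < 1 :=
      Real.rpow_lt_one_of_one_lt_of_neg one_lt_two (by linarith)
    have hs := (summable_geometric_of_lt_one hr0 hr1).mul_left C
    refine ne_top_of_le_ne_top hs.tsum_ofReal_ne_top (ENNReal.tsum_le_tsum fun n => ?_)
    rw [lintegral_finsetSum _ fun i _ => hmeas n i]
    have hterm : ∀ i : Fin (2 ^ n), ∫⁻ ω,
        (if ω ∈ A n i then ENNReal.ofReal ((2 ^ n)⁻¹) ^ d else 0) ∂μ ≤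
        ENNReal.ofReal ((2 ^ n)⁻¹) ^ d * ENNReal.ofReal (C * 2 ^ (-(n : ℝ) * β)) := by
      intro i
      have : (fun ω => if ω ∈ A n i then ENNReal.ofReal ((2 ^ n)⁻¹) ^ d else 0) =
          (A n i).indicator fun _ => ENNReal.ofReal ((2 ^ n)⁻¹) ^ d := by
        ext ω; simp [indicator]
      rw [this, lintegral_indicator_const (hA n i)]
      gcongr
      exact hC n i i.2
    refine (Finset.sum_le_sum fun i _ => hterm i).trans ?_
    rw [Finset.sum_const, Finset.card_univ, Fintype.card_fin, nsmul_eq_mul,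
      ENNReal.ofReal_rpow_of_pos (by positivity), ← ENNReal.ofReal_mul (by positivity),
      ← ENNReal.ofReal_natCast, ← ENNReal.ofReal_mul (by positivity)]
    apply ENNReal.ofReal_le_ofReal
    apply le_of_eq
    have h2 : (0 : ℝ) < 2 := two_pos
    push_cast
    rw [← Real.rpow_natCast 2 n, ← Real.rpow_natCast (2 ^ (1 - β - d)) n, ← Real.rpow_neg h2.le,
      ← Real.rpow_mul h2.le, ← Real.rpow_mul h2.le,
      show (1 - β - d) * (n : ℝ) = n + (-n * d + -n * β) by ring,
      Real.rpow_add h2, Real.rpow_add h2]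
    ring
  filter_upwards [ae_lt_top (Measurable.tsum hsum) hfin] with ω hω using hω.ne

/-- upper bound on the dimension of a limsup fractal on the binary tree. -/
theorem statement9
    {Ω : Type*} [MeasureSpace Ω] [IsProbabilityMeasure (ℙ : Measure Ω)]
    (Z : ℕ → ℕ → Ω → ℝ) (hZmeas : ∀ n i, Measurable (Z n i))
    (hZ01 : ∀ n i ω, Z n i ω ∈ Set.Icc (0 : ℝ) 1)
    (hZident : ∀ n i, i < 2 ^ n → IdentDistrib (Z n i) (Z n 0) ℙ ℙ)
    (β : ℝ) (hβ0 : 0 < β) (hβ1 : β ≤ 1)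
    (C : ℝ) (hC : ∀ n : ℕ, (ℙ {ω | 0 < Z n 0 ω}).toReal ≤ C * 2 ^ (-(n : ℝ) * β)) :
    ∀ᵐ ω ∂ℙ, dimH {θ : ℝ | θ ∈ Set.Ico (0 : ℝ) 1 ∧
        ∃ᶠ n : ℕ in atTop, 0 < Z n ⌊2 ^ n * θ⌋₊ ω} ≤
      ENNReal.ofReal (1 - β) := by
  classical
  have hP : ∀ n i, i < 2 ^ n →
      ℙ {ω | 0 < Z n i ω} ≤ ENNReal.ofReal (C * 2 ^ (-(n : ℝ) * β)) := by
    intro n i hi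
    have : ℙ {ω | 0 < Z n i ω} = ℙ {ω | 0 < Z n 0 ω} :=
      (hZident n i hi).measure_mem_eq measurableSet_Ioi
    rw [this]
    exact ENNReal.le_ofReal_iff_toReal_le (measure_ne_top _ _)
      (ENNReal.toReal_nonneg.trans (hC n)) |>.2 (hC n)
  obtain ⟨u, -, hu, hlim⟩ := exists_seq_strictAnti_tendsto (1 - β)
  have hae : ∀ᵐ ω ∂ℙ, ∀ k, ∑' n : ℕ, ∑ i : Fin (2 ^ n),
      (if 0 < Z n i ω then ENNReal.ofReal ((2 ^ n)⁻¹) ^ u k else 0) ≠ ∞ :=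
    ae_all_iff.2 fun k => ae_dyadic_content_ne_top ℙ (fun n i => {ω | 0 < Z n i ω})
      (fun n i => measurableSet_lt measurable_const (hZmeas n i)) (hu k) hP
  filter_upwards [hae] with ω hω
  refine ge_of_tendsto' (ENNReal.tendsto_ofReal hlim) fun k => ?_
  have hk : 0 < u k := (sub_nonneg.2 hβ1).trans_lt (hu k)
  have h0 := hausdorffMeasure_dyadic_limsup_eq_zero (fun n i => 0 < Z n i ω) hk (hω k)
  refine dimH_le_of_hausdorffMeasure_ne_top (d := (u k).toNNReal) ?_
  rw [Real.coe_toNNReal _ hk.le, h0]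
  exact ENNReal.zero_ne_top
end

section
/- Suppose m_n > 0 for all n, and that there exist a sequence ζ(n) ≥ 1 and a real 0 < γ < 1 such that: (i) for every m ≤ n and every vertex u at level m, E(M_n(u)) = m_n·2^{n−m} and Var(M_n(u)) ≤ ζ(n)·m_n·2^{n−m}; and (ii) 2^{n(γ−1)}·ζ(n)/m_n → 0 as n → ∞. Then almost surely the Hausdorff dimension of the limsup fractal D is at least γ. -/
open MeasureTheory ProbabilityTheory Filter Set

lemma mem_Ico_iff_div_two_pow (j k i : ℕ) :
    i ∈ Finset.Ico (j * 2 ^ k) ((j + 1) * 2 ^ k) ↔ i / 2 ^ k = j := by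
  rw [Finset.mem_Ico, Nat.div_eq_iff (by positivity)]
  have : 0 < 2 ^ k := by positivity
  have h2 : (j + 1) * 2 ^ k = j * 2 ^ k + 2 ^ k := by ring
  omega

/-- The sum of `z` over the descendants at level `n` of the dyadic vertex `v`. -/
noncomputable def dyadicMass (z : ℕ → ℝ) (n : ℕ) (v : ℕ × ℕ) : ℝ :=
  ∑ i ∈ Finset.Ico (v.2 * 2 ^ (n - v.1)) ((v.2 + 1) * 2 ^ (n - v.1)), z i

/-- The weighted quadratic deviation of the vertex masses from their means `a * 2 ^ (n - l)`. -/
noncomputable def dyadicDeviation (p a : ℝ) (z : ℕ → ℝ) (n : ℕ) : ℝ :=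
  ∑ l ∈ Finset.range (n + 1), ∑ j ∈ Finset.range (2 ^ l),
    (p ^ l)⁻¹ * (dyadicMass z n (l, j) - a * 2 ^ (n - l)) ^ 2

lemma sum_deviation_le {p a : ℝ} (hp : 0 < p) (z : ℕ → ℝ) (n : ℕ) (F : Finset (ℕ × ℕ))
    (hF : ∀ v ∈ F, v.1 ≤ n ∧ v.2 < 2 ^ v.1) :
    ∑ v ∈ F, (p ^ v.1)⁻¹ * (dyadicMass z n v - a * 2 ^ (n - v.1)) ^ 2
      ≤ dyadicDeviation p a z n := by
  unfold dyadicDeviation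
  rw [Finset.sum_sigma']
  have key : ∑ v ∈ F, (p ^ v.1)⁻¹ * (dyadicMass z n v - a * 2 ^ (n - v.1)) ^ 2
      = ∑ x ∈ F.image (fun v => (⟨v.1, v.2⟩ : Σ _ : ℕ, ℕ)),
        (p ^ x.1)⁻¹ * (dyadicMass z n (x.1, x.2) - a * 2 ^ (n - x.1)) ^ 2 := by
    rw [Finset.sum_image]
    intro x _ y _ h
    simp only [Sigma.mk.injEq, heq_eq_eq] at h
    exact Prod.ext h.1 h.2
  rw [key]
  apply Finset.sum_le_sum_of_subset_of_nonneg
  · intro x hx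
    simp only [Finset.mem_image] at hx
    obtain ⟨v, hv, rfl⟩ := hx
    have := hF v hv
    simp only [Finset.mem_sigma, Finset.mem_range]
    omega
  · intros; positivity

/-- A family of descendants of `(m, i)` of small total weight does not cover
all the level-`n` vertices of positive mass, if the masses are well spread. -/
lemma exists_pos_not_covered {p a η : ℝ} (hp : 1 / 2 < p) (hp1 : p < 1) (ha : 0 < a)
    {z : ℕ → ℝ} (hz : ∀ i, 0 ≤ z i) {m n i : ℕ} (hmn : m ≤ n) (hi : i < 2 ^ m)
    (hη : 0 ≤ η) (hηm : 2 * η < (1 / 2) ^ m * (1 - 1 / (2 * p)))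
    (hQ : dyadicDeviation p a z n ≤ (η * (a * 2 ^ n)) ^ 2)
    (F : Finset (ℕ × ℕ)) (hF : ∀ v ∈ F, m ≤ v.1 ∧ v.1 ≤ n ∧ v.2 / 2 ^ (v.1 - m) = i)
    (hS : ∑ v ∈ F, p ^ v.1 < p ^ m) :
    ∃ k, k / 2 ^ (n - m) = i ∧ 0 < z k ∧ ∀ v ∈ F, k / 2 ^ (n - v.1) ≠ v.2 := by
  have hp0 : 0 < p := by linarith
  by_contra! hcon
  set A : ℝ := a * 2 ^ n with hA
  have hA0 : 0 < A := by positivity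
  have hlev : ∀ l, l ≤ n → a * 2 ^ (n - l) = A * (1 / 2) ^ l := by
    intro l hl
    obtain ⟨d, rfl⟩ := Nat.exists_eq_add_of_le hl
    simp only [hA, Nat.add_sub_cancel_left, pow_add, one_div, inv_pow]
    field_simp
  have hcover : dyadicMass z n (m, i) ≤ ∑ v ∈ F, dyadicMass z n v := by
    calc dyadicMass z n (m, i)
        ≤ ∑ k ∈ Finset.Ico (i * 2 ^ (n - m)) ((i + 1) * 2 ^ (n - m)),
            ∑ v ∈ F, if k / 2 ^ (n - v.1) = v.2 then z k else 0 := by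
          apply Finset.sum_le_sum
          intro k hk
          rw [mem_Ico_iff_div_two_pow] at hk
          have hnn : ∀ v ∈ F, 0 ≤ if k / 2 ^ (n - v.1) = v.2 then z k else 0 := by
            intro v _
            split_ifs
            exacts [hz k, le_rfl]
          rcases (hz k).eq_or_lt with h0 | h0
          · rw [← h0]; simp
          · obtain ⟨v, hv, hkv⟩ := hcon k hk h0
            refine le_trans ?_ (Finset.single_le_sum hnn hv)
            simp [hkv]
      _ = ∑ v ∈ F, ∑ k ∈ Finset.Ico (i * 2 ^ (n - m)) ((i + 1) * 2 ^ (n - m)),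
            if k / 2 ^ (n - v.1) = v.2 then z k else 0 := Finset.sum_comm
      _ ≤ ∑ v ∈ F, dyadicMass z n v := by
          apply Finset.sum_le_sum
          intro v _
          rw [← Finset.sum_filter]
          apply Finset.sum_le_sum_of_subset_of_nonneg
          · intro k hk
            rw [Finset.mem_filter] at hk
            exact (mem_Ico_iff_div_two_pow _ _ _).2 hk.2
          · intro k _ _; exact hz k
  have hFv : ∀ v ∈ F, v.1 ≤ n ∧ v.2 < 2 ^ v.1 := by
    intro v hv
    obtain ⟨h1, h2, h3⟩ := hF v hv
    refine ⟨h2, ?_⟩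
    have : v.2 / 2 ^ (v.1 - m) < 2 ^ m := by omega
    rw [Nat.div_lt_iff_lt_mul (by positivity), ← pow_add] at this
    rwa [show m + (v.1 - m) = v.1 by omega] at this
  have hnotin : ∀ v ∈ F, m + 1 ≤ v.1 := by
    intro v hv
    by_contra hlt
    have hvm : v.1 = m := by have := (hF v hv).1; omega
    have := Finset.single_le_sum (f := fun v : ℕ × ℕ => p ^ v.1)
      (fun w _ => by positivity) hv
    simp only [hvm] at this
    linarith
  set S := ∑ v ∈ F, p ^ v.1 with hSdef
  have hS0 : 0 ≤ S := Finset.sum_nonneg fun _ _ => by positivity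
  have hS1 : S ≤ 1 := hS.le.trans (pow_le_one₀ hp0.le hp1.le)
  set δ : ℕ × ℕ → ℝ := fun v => dyadicMass z n v - a * 2 ^ (n - v.1) with hδ
  have hdev : ∑ v ∈ F, δ v ≤ η * A := by
    have hcs := Finset.sum_sq_le_sum_mul_sum_of_sq_le_mul F (r := δ)
      (f := fun v => (p ^ v.1)⁻¹ * δ v ^ 2) (g := fun v => p ^ v.1)
      (fun v _ => by positivity) (fun v _ => by positivity)
      (fun v _ => by
        have : p ^ v.1 ≠ 0 := by positivity
        exact (by field_simp : δ v ^ 2 = (p ^ v.1)⁻¹ * δ v ^ 2 * p ^ v.1).le)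
    have h1 := sum_deviation_le (a := a) hp0 z n F hFv
    refine le_of_sq_le_sq ?_ (by positivity)
    calc (∑ v ∈ F, δ v) ^ 2 ≤ _ := hcs
      _ ≤ (η * A) ^ 2 * 1 := mul_le_mul (h1.trans hQ) hS1 hS0 (by positivity)
      _ = _ := mul_one _
  have hroot : -(η * A) ≤ δ (m, i) := by
    have h1 := sum_deviation_le (a := a) hp0 z n {(m, i)} (by simpa using ⟨hmn, hi⟩)
    rw [Finset.sum_singleton] at h1
    have h2 : δ (m, i) ^ 2 ≤ (η * A) ^ 2 := by
      refine le_trans ?_ (h1.trans hQ)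
      exact le_mul_of_one_le_left (sq_nonneg _)
        ((one_le_inv₀ (by positivity)).2 (pow_le_one₀ hp0.le hp1.le))
    exact (abs_le_of_sq_le_sq' h2 (by positivity)).1
  have hmean : ∑ v ∈ F, (1 / 2 : ℝ) ^ v.1 ≤ (1 / 2) ^ m * (1 / (2 * p)) := by
    have hb : ∀ v ∈ F, (1 / 2 : ℝ) ^ v.1 ≤ p ^ v.1 * (1 / (2 * p)) ^ (m + 1) := by
      intro v hv
      have : (1 / 2 : ℝ) ^ v.1 = p ^ v.1 * (1 / (2 * p)) ^ v.1 := by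
        rw [← mul_pow]; congr 1; field_simp
      rw [this]
      apply mul_le_mul_of_nonneg_left _ (by positivity)
      apply pow_le_pow_of_le_one (by positivity) _ (hnotin v hv)
      rw [div_le_one (by positivity)]; linarith
    calc _ ≤ ∑ v ∈ F, p ^ v.1 * (1 / (2 * p)) ^ (m + 1) := Finset.sum_le_sum hb
      _ = S * (1 / (2 * p)) ^ (m + 1) := by rw [Finset.sum_mul]
      _ ≤ p ^ m * (1 / (2 * p)) ^ (m + 1) := by gcongr
      _ = _ := by rw [pow_succ, ← mul_assoc, ← mul_pow]; congr 2; field_simp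
  have hsum : ∑ v ∈ F, dyadicMass z n v = A * ∑ v ∈ F, (1 / 2 : ℝ) ^ v.1 + ∑ v ∈ F, δ v := by
    rw [Finset.mul_sum, ← Finset.sum_add_distrib]
    refine Finset.sum_congr rfl fun v hv => ?_
    rw [hδ, ← hlev _ (hFv v hv).1]; ring
  have hI : dyadicMass z n (m, i) = A * (1 / 2) ^ m + δ (m, i) := by
    rw [hδ, ← hlev _ hmn]; ring
  have := mul_le_mul_of_nonneg_left hmean hA0.le
  have := mul_lt_mul_of_pos_left hηm hA0
  nlinarith

/-- The set of descendants of the dyadic vertex `(m, i)`. -/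
def dyadicCone (m i : ℕ) : Set (ℕ × ℕ) := {v | m ≤ v.1 ∧ v.2 / 2 ^ (v.1 - m) = i}

lemma div_two_pow_div {l m n : ℕ} (h1 : m ≤ l) (h2 : l ≤ n) (i : ℕ) :
    i / 2 ^ (n - l) / 2 ^ (l - m) = i / 2 ^ (n - m) := by
  rw [Nat.div_div_eq_div_mul, ← pow_add]
  congr 2; omega

lemma exists_next_vertex {p : ℝ} (hp : 1 / 2 < p) (hp1 : p < 1) {a : ℕ → ℝ} (ha : ∀ n, 0 < a n)
    {z : ℕ → ℕ → ℝ} (hz : ∀ n i, 0 ≤ z n i)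
    (hQ : ∀ η > 0, ∃ᶠ n in atTop, dyadicDeviation p (a n) (z n) n ≤ (η * (a n * 2 ^ n)) ^ 2)
    (ν : Measure (ℕ × ℕ)) {m i : ℕ} (hi : i < 2 ^ m)
    (hν : ν (dyadicCone m i) < ENNReal.ofReal (p ^ m))
    (hanc : ∀ l < m, ν {(l, i / 2 ^ (m - l))} < ENNReal.ofReal (p ^ l)) :
    ∃ n k, (k < 2 ^ n ∧ ν (dyadicCone n k) < ENNReal.ofReal (p ^ n) ∧
        ∀ l < n, ν {(l, k / 2 ^ (n - l))} < ENNReal.ofReal (p ^ l)) ∧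
      m < n ∧ k / 2 ^ (n - m) = i ∧ k + 1 < (i + 1) * 2 ^ (n - m) ∧ 0 < z n k := by
  classical
  have hp0 : 0 < p := by linarith
  set c : ℝ := (1 / 2) ^ m * (1 - 1 / (2 * p)) with hc
  have hc0 : 0 < c := by
    have : 1 / (2 * p) < 1 := by rw [div_lt_one (by positivity)]; linarith
    have : 0 < 1 - 1 / (2 * p) := by linarith
    positivity
  obtain ⟨s, hs⟩ : ∃ s : ℝ, s = (ν (dyadicCone m i)).toReal := ⟨_, rfl⟩
  have hνs : ν (dyadicCone m i) = ENNReal.ofReal s := by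
    rw [hs, ENNReal.ofReal_toReal hν.ne_top]
  have hsp : s < p ^ m := by
    rw [hνs] at hν
    exact (ENNReal.ofReal_lt_ofReal_iff (by positivity)).1 hν
  have hs0 : 0 ≤ s := by rw [hs]; positivity
  have hgap : ∀ᶠ n : ℕ in atTop, p ^ n < p ^ m - s :=
    (tendsto_pow_atTop_nhds_zero_of_lt_one hp0.le hp1).eventually_lt_const (by linarith)
  obtain ⟨n, hQn, hgapn, hmn⟩ :=
    ((hQ (c / 4) (by positivity)).and_eventually (hgap.and (eventually_gt_atTop m))).exists
  set g : ℕ × ℕ → ℕ × ℕ := fun v => if v.1 ≤ n then v else (n, v.2 / 2 ^ (v.1 - n)) with hg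
  set F₀ : Finset (ℕ × ℕ) := (Finset.Icc m n ×ˢ Finset.range (2 ^ n)).filter
    fun v => v.2 / 2 ^ (v.1 - m) = i ∧ ENNReal.ofReal (p ^ v.1) ≤ ν (g ⁻¹' {v}) with hF₀
  have hF₀s : ∑ v ∈ F₀, p ^ v.1 ≤ s := by
    rw [← ENNReal.ofReal_le_ofReal_iff hs0, ← hνs,
      ENNReal.ofReal_sum_of_nonneg (fun _ _ => by positivity)]
    calc ∑ v ∈ F₀, ENNReal.ofReal (p ^ v.1) ≤ ∑ v ∈ F₀, ν (g ⁻¹' {v}) :=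
          Finset.sum_le_sum fun v hv => (Finset.mem_filter.1 hv).2.2
      _ = ν (g ⁻¹' F₀) :=
          sum_measure_preimage_singleton F₀ fun _ _ => MeasurableSet.of_discrete
      _ ≤ ν (dyadicCone m i) := by
          apply measure_mono
          intro v hv
          simp only [hF₀, hg, mem_preimage, Finset.coe_filter, mem_ofPred_eq, Finset.mem_product,
            Finset.mem_Icc] at hv
          split_ifs at hv with h
          · exact ⟨hv.1.1.1, hv.2.1⟩
          · refine ⟨by omega, ?_⟩
            have h3 := hv.2.1
            dsimp only at h3
            rwa [div_two_pow_div hmn.le (by omega)] at h3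
  have hpos : 0 < 2 ^ (n - m) := by positivity
  have hexp : (i + 1) * 2 ^ (n - m) = i * 2 ^ (n - m) + 2 ^ (n - m) := by ring
  set r : ℕ := (i + 1) * 2 ^ (n - m) - 1 with hr
  have hri : r / 2 ^ (n - m) = i := by
    rw [← mem_Ico_iff_div_two_pow, Finset.mem_Ico]; omega
  obtain ⟨k, hki, hzk, hk⟩ := exists_pos_not_covered (η := c / 4) hp hp1 (ha n) (hz n) hmn.le hi
    (by positivity) (by linarith) hQn (insert (n, r) F₀)
    (by
      intro v hv
      rw [Finset.mem_insert] at hv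
      rcases hv with rfl | hv
      · exact ⟨hmn.le, le_rfl, hri⟩
      · simp only [hF₀, Finset.mem_filter, Finset.mem_product, Finset.mem_Icc] at hv
        exact ⟨hv.1.1.1, hv.1.1.2, hv.2.1⟩)
    (by
      by_cases h : (n, r) ∈ F₀
      · rw [Finset.insert_eq_of_mem h]; linarith
      · rw [Finset.sum_insert h]; dsimp only; linarith)
  have hkr : k ≠ r := by
    have := hk (n, r) (Finset.mem_insert_self _ _)
    simpa using this
  have hkI := (mem_Ico_iff_div_two_pow i (n - m) k).2 hki
  rw [Finset.mem_Ico] at hkI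
  have hk2 : k < 2 ^ n := by
    have h1 : (i + 1) * 2 ^ (n - m) ≤ 2 ^ m * 2 ^ (n - m) := Nat.mul_le_mul_right _ hi
    rw [← pow_add, show m + (n - m) = n by omega] at h1
    omega
  have hfib : ∀ l, m ≤ l → l ≤ n →
      ν (g ⁻¹' {(l, k / 2 ^ (n - l))}) < ENNReal.ofReal (p ^ l) := by
    intro l h1 h2
    by_contra! hge
    refine hk (l, k / 2 ^ (n - l)) (Finset.mem_insert_of_mem ?_) rfl
    simp only [hF₀, Finset.mem_filter, Finset.mem_product, Finset.mem_Icc, Finset.mem_range]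
    exact ⟨⟨⟨h1, h2⟩, (Nat.div_le_self _ _).trans_lt hk2⟩,
      (div_two_pow_div h1 h2 k).trans hki, hge⟩
  refine ⟨n, k, ⟨hk2, ?_, ?_⟩, hmn, hki, by omega, hzk⟩
  · refine lt_of_le_of_lt (measure_mono ?_) (hfib n hmn.le le_rfl)
    rintro ⟨l, j⟩ ⟨h1, h2⟩
    dsimp only at h1 h2
    simp only [hg, mem_preimage, mem_singleton_iff, Nat.sub_self, pow_zero, Nat.div_one]
    split_ifs with h
    · obtain rfl : l = n := by omega
      simpa using h2
    · simpa using h2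
  · intro l hl
    rcases lt_or_ge l m with h | h
    · have := hanc l h
      rwa [← hki, div_two_pow_div h.le hmn.le] at this
    · refine lt_of_le_of_lt (measure_mono ?_) (hfib l h hl.le)
      rintro v rfl
      simp [hg, hl.le]

lemma natFloor_two_pow_mul_of_mem {x : ℝ} {n l k : ℕ} (hl : l ≤ n)
    (h1 : (k : ℝ) / 2 ^ n ≤ x) (h2 : x < (k + 1) / 2 ^ n) :
    ⌊2 ^ l * x⌋₊ = k / 2 ^ (n - l) := by
  have hx : 0 ≤ x := le_trans (by positivity) h1
  have hfl : ⌊2 ^ n * x⌋₊ = k := by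
    rw [Nat.floor_eq_iff (by positivity)]
    rw [div_le_iff₀ (by positivity)] at h1
    rw [lt_div_iff₀ (by positivity)] at h2
    constructor <;> linarith
  rw [← hfl, ← Nat.floor_div_natCast]
  congr 1
  rw [eq_div_iff (by positivity)]
  push_cast
  rw [mul_right_comm, ← pow_add, show l + (n - l) = n by omega]

/-- A measure on the vertices of small mass leaves a point of the limsup set uncovered. -/
lemma exists_limsup_point {p : ℝ} (hp : 1 / 2 < p) (hp1 : p < 1) {a : ℕ → ℝ} (ha : ∀ n, 0 < a n)
    {z : ℕ → ℕ → ℝ} (hz : ∀ n i, 0 ≤ z n i)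
    (hQ : ∀ η > 0, ∃ᶠ n in atTop, dyadicDeviation p (a n) (z n) n ≤ (η * (a n * 2 ^ n)) ^ 2)
    (ν : Measure (ℕ × ℕ)) (hν : ν univ < 1) :
    ∃ θ ∈ Ico (0 : ℝ) 1, (∃ᶠ n in atTop, 0 < z n ⌊2 ^ n * θ⌋₊) ∧
      ∀ l, ν {(l, ⌊2 ^ l * θ⌋₊)} < ENNReal.ofReal (p ^ l) := by
  let V := {v : ℕ × ℕ // v.2 < 2 ^ v.1 ∧ ν (dyadicCone v.1 v.2) < ENNReal.ofReal (p ^ v.1) ∧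
    ∀ l < v.1, ν {(l, v.2 / 2 ^ (v.1 - l))} < ENNReal.ofReal (p ^ l)}
  have hstep : ∀ v : V, ∃ w : V, v.1.1 < w.1.1 ∧ w.1.2 / 2 ^ (w.1.1 - v.1.1) = v.1.2 ∧
      w.1.2 + 1 < (v.1.2 + 1) * 2 ^ (w.1.1 - v.1.1) ∧ 0 < z w.1.1 w.1.2 := by
    rintro ⟨⟨m, i⟩, h1, h2, h3⟩
    obtain ⟨n, k, hv, h⟩ := exists_next_vertex hp hp1 ha hz hQ ν h1 h2 h3
    exact ⟨⟨(n, k), hv⟩, h⟩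
  choose f hf1 hf2 hf3 hf4 using hstep
  let v₀ : V := ⟨(0, 0), by simp, by
    simpa using (measure_mono (subset_univ _)).trans_lt hν, by simp⟩
  let s : ℕ → V := fun k => f^[k] v₀
  have hs : ∀ k, s (k + 1) = f (s k) := fun k => Function.iterate_succ_apply' f k v₀
  let N : ℕ → ℕ := fun k => (s k).1.1
  let I : ℕ → ℕ := fun k => (s k).1.2
  have hN : StrictMono N := strictMono_nat_of_lt_succ fun k => by
    have := hf1 (s k); rw [← hs] at this; exact this
  have hpow : ∀ k, (2 : ℝ) ^ N (k + 1) = 2 ^ N k * 2 ^ (N (k + 1) - N k) := fun k => by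
    have := hN (Nat.lt_add_one k)
    rw [← pow_add]; congr 1; omega
  have hleft : ∀ k, (I k : ℝ) / 2 ^ N k ≤ I (k + 1) / 2 ^ N (k + 1) := fun k => by
    have h := hf2 (s k)
    rw [← hs, ← mem_Ico_iff_div_two_pow, Finset.mem_Ico] at h
    have h' : (I k : ℝ) * 2 ^ (N (k + 1) - N k) ≤ I (k + 1) := by exact_mod_cast h.1
    rw [hpow, div_le_div_iff₀ (by positivity) (by positivity)]
    have : (0 : ℝ) < 2 ^ N k := by positivity
    nlinarith
  have hright : ∀ k, ((I (k + 1) : ℝ) + 1) / 2 ^ N (k + 1) < (I k + 1) / 2 ^ N k := fun k => by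
    have h := hf3 (s k)
    rw [← hs] at h
    have h' : (I (k + 1) : ℝ) + 1 < (I k + 1) * 2 ^ (N (k + 1) - N k) := by exact_mod_cast h
    rw [hpow, div_lt_div_iff₀ (by positivity) (by positivity)]
    have : (0 : ℝ) < 2 ^ N k := by positivity
    nlinarith
  have hanti : Antitone fun k => Icc ((I k : ℝ) / 2 ^ N k) ((I k + 1) / 2 ^ N k) :=
    antitone_nat_of_succ_le fun k => Icc_subset_Icc (hleft k) (hright k).le
  have hmem := ciSup_mem_iInter_Icc_of_antitone_Icc hanti
    (fun k => by gcongr; linarith)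
  obtain ⟨θ, hθ⟩ : ∃ θ : ℝ, θ = ⨆ k, (I k : ℝ) / 2 ^ N k := ⟨_, rfl⟩
  rw [← hθ, mem_iInter] at hmem
  have hlt : ∀ k, θ < (I k + 1) / 2 ^ N k := fun k => (hmem (k + 1)).2.trans_lt (hright k)
  have hfloor : ∀ k l, l ≤ N k → ⌊2 ^ l * θ⌋₊ = I k / 2 ^ (N k - l) := fun k l hl =>
    natFloor_two_pow_mul_of_mem hl (hmem k).1 (hlt k)
  refine ⟨θ, ⟨le_trans (by positivity) (hmem 0).1, ?_⟩, ?_, fun l => ?_⟩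
  · have := hlt 0
    simpa [N, I, s, v₀] using this
  · rw [frequently_atTop]
    intro b
    refine ⟨N (b + 1), (Nat.le_succ b).trans (hN.le_apply), ?_⟩
    rw [hfloor (b + 1) _ le_rfl]
    have := hf4 (s b)
    rw [← hs] at this
    simpa using this
  · have hl : l < N (l + 1) := (Nat.lt_succ_self l).trans_le (hN.le_apply)
    rw [hfloor (l + 1) l hl.le]
    exact (s (l + 1)).2.2.2 l hl

lemma exists_dyadic_scale {γ : ℝ} (hγ0 : 0 < γ) (hγ1 : γ < 1) {d ε : ENNReal}
    (hd : d ≤ ENNReal.ofReal (1 / 4)) (hε : 0 < ε) :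
    ∃ l : ℕ, d < ENNReal.ofReal ((1 / 2) ^ l) ∧
      ENNReal.ofReal (((2 : ℝ) ^ (-γ)) ^ l) ≤ 4 * d ^ γ + ε := by
  have hp0 : (0 : ℝ) < 2 ^ (-γ) := by positivity
  have hp1 : (2 : ℝ) ^ (-γ) < 1 := Real.rpow_lt_one_of_one_lt_of_neg (by norm_num) (by linarith)
  rcases eq_or_ne d 0 with rfl | h0
  · have ht : Tendsto (fun l : ℕ => ENNReal.ofReal (((2 : ℝ) ^ (-γ)) ^ l)) atTop (nhds 0) := by
      simpa using ENNReal.tendsto_ofReal (tendsto_pow_atTop_nhds_zero_of_lt_one hp0.le hp1)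
    obtain ⟨l, hl⟩ := (ht.eventually_lt_const hε).exists
    exact ⟨l, by simp, hl.le.trans le_add_self⟩
  · have htop : d ≠ ⊤ := ne_top_of_le_ne_top ENNReal.ofReal_ne_top hd
    obtain ⟨x, hx⟩ : ∃ x : ℝ, x = d.toReal := ⟨_, rfl⟩
    have hdx : d = ENNReal.ofReal x := by rw [hx, ENNReal.ofReal_toReal htop]
    have hx0 : 0 < x := by rw [hx]; exact ENNReal.toReal_pos h0 htop
    have hx1 : x ≤ 1 / 4 := by
      rw [hdx] at hd
      exact (ENNReal.ofReal_le_ofReal_iff (by norm_num)).1 hd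
    obtain ⟨l, hl1, hl2⟩ := exists_nat_pow_near_of_lt_one (x := 2 * x) (y := 1 / 2)
      (by linarith) (by linarith) (by norm_num) (by norm_num)
    refine ⟨l, ?_, ?_⟩
    · rw [hdx]
      exact (ENNReal.ofReal_lt_ofReal_iff (by positivity)).2 (by linarith)
    · refine le_trans ?_ le_self_add
      rw [hdx, ENNReal.ofReal_rpow_of_pos hx0, show (4 : ENNReal) = ENNReal.ofReal 4 by simp,
        ← ENNReal.ofReal_mul (by norm_num)]
      apply ENNReal.ofReal_le_ofReal
      have hpl : ((2 : ℝ) ^ (-γ)) ^ l = ((1 / 2 : ℝ) ^ l) ^ γ := by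
        rw [← Real.rpow_natCast, ← Real.rpow_natCast, ← Real.rpow_mul (by norm_num),
          ← Real.rpow_mul (by norm_num), one_div, Real.inv_rpow (by norm_num),
          ← Real.rpow_neg (by norm_num)]
        congr 1; ring
      rw [hpl]
      have h4 : (1 / 2 : ℝ) ^ l ≤ 4 * x := by
        rw [pow_succ] at hl1; linarith
      calc ((1 / 2 : ℝ) ^ l) ^ γ ≤ (4 * x) ^ γ := by gcongr
        _ = 4 ^ γ * x ^ γ := Real.mul_rpow (by norm_num) hx0.le
        _ ≤ 4 * x ^ γ := by
            gcongr
            exact Real.rpow_le_self_of_one_le (by norm_num) hγ1.le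

/-- A set of zero Hausdorff measure is covered by dyadic intervals of small total weight. -/
lemma exists_dyadic_cover {γ : ℝ} (hγ0 : 0 < γ) (hγ1 : γ < 1) {D : Set ℝ} (hD : D ⊆ Ici 0)
    (h : μH[γ] D = 0) :
    ∃ ν : Measure (ℕ × ℕ), ν univ < 1 ∧ ∀ θ ∈ D, ∃ l : ℕ,
      ENNReal.ofReal (((2 : ℝ) ^ (-γ)) ^ l) ≤ ν {(l, ⌊2 ^ l * θ⌋₊)} := by
  classical
  set c : ENNReal := ENNReal.ofReal (1 / 100) with hc
  have hc0 : c ≠ 0 := by simp [hc]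
  obtain ⟨t, hDt, htd, hts⟩ : ∃ t : ℕ → Set ℝ, D ⊆ ⋃ n, t n ∧
      (∀ n, Metric.ediam (t n) ≤ ENNReal.ofReal (1 / 4)) ∧
      ∑' n, ⨆ _ : (t n).Nonempty, Metric.ediam (t n) ^ γ < c := by
    rw [Measure.hausdorffMeasure_apply] at h
    have h' := (iSup₂_le_iff.1 h.le) (ENNReal.ofReal (1 / 4)) (by simp)
    simpa only [iInf_lt_iff, exists_prop] using h'.trans_lt (pos_iff_ne_zero.2 hc0)
  obtain ⟨ε, hε0, hεs⟩ := ENNReal.exists_pos_sum_of_countable hc0 ℕ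
  choose l hl1 hl2 using fun k =>
    exists_dyadic_scale hγ0 hγ1 (htd k) (ε := ε k) (by exact_mod_cast hε0 k)
  have hx : ∀ k, ∃ x : ℝ, (t k ∩ D).Nonempty → x ∈ t k ∩ D := fun k => by
    by_cases hne : (t k ∩ D).Nonempty
    · exact ⟨_, fun _ => hne.some_mem⟩
    · exact ⟨0, fun h => absurd h hne⟩
  choose x hx using hx
  let j : ℕ → ℕ := fun k => ⌊2 ^ l k * x k⌋₊
  let w : ℕ → ENNReal := fun k => ENNReal.ofReal (((2 : ℝ) ^ (-γ)) ^ l k)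
  let κ : ℕ → Measure (ℕ × ℕ) := fun k => Measure.dirac (l k, j k - 1) +
    Measure.dirac (l k, j k) + Measure.dirac (l k, j k + 1)
  refine ⟨Measure.sum fun k => w k • κ k, ?_, fun θ hθ => ?_⟩
  · rw [Measure.sum_apply _ MeasurableSet.univ]
    have hw : ∀ k, (w k • κ k) univ ≤
        12 * (⨆ _ : (t k).Nonempty, Metric.ediam (t k) ^ γ) + 3 * ε k := fun k => by
      have hsup : Metric.ediam (t k) ^ γ ≤ ⨆ _ : (t k).Nonempty, Metric.ediam (t k) ^ γ := by
        rcases (t k).eq_empty_or_nonempty with he | hne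
        · simp [he, hγ0]
        · simp [hne]
      have h3 : (w k • κ k) univ = 3 * w k := by
        simp only [κ, Measure.smul_apply, Measure.add_apply, measure_univ, smul_eq_mul]
        ring
      rw [h3]
      calc 3 * w k ≤ 3 * (4 * Metric.ediam (t k) ^ γ + ε k) := by gcongr; exact hl2 k
        _ = 12 * Metric.ediam (t k) ^ γ + 3 * ε k := by ring
        _ ≤ _ := by gcongr
    calc ∑' k, (w k • κ k) univ
        ≤ ∑' k, (12 * (⨆ _ : (t k).Nonempty, Metric.ediam (t k) ^ γ) + 3 * (ε k : ENNReal)) :=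
          ENNReal.tsum_le_tsum hw
      _ = 12 * ∑' k, (⨆ _ : (t k).Nonempty, Metric.ediam (t k) ^ γ)
            + 3 * ∑' k, (ε k : ENNReal) := by
          rw [ENNReal.tsum_add, ENNReal.tsum_mul_left, ENNReal.tsum_mul_left]
      _ ≤ 12 * c + 3 * c := by gcongr
      _ = ENNReal.ofReal (15 / 100) := by
          rw [← add_mul, hc, show (12 + 3 : ENNReal) = ENNReal.ofReal 15 by norm_num,
            ← ENNReal.ofReal_mul (by norm_num)]
          norm_num
      _ < 1 := by rw [ENNReal.ofReal_lt_one]; norm_num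
  · obtain ⟨k, hk⟩ := mem_iUnion.1 (hDt hθ)
    have hxk := hx k ⟨θ, hk, hθ⟩
    have hdist : |θ - x k| < (1 / 2) ^ l k := by
      have := (Metric.edist_le_ediam_of_mem hk hxk.1).trans_lt (hl1 k)
      rwa [edist_dist, ENNReal.ofReal_lt_ofReal_iff (by positivity), Real.dist_eq] at this
    refine ⟨l k, ?_⟩
    have hmul : |2 ^ l k * θ - 2 ^ l k * x k| < 1 := by
      rw [← mul_sub, abs_mul, abs_of_pos (by positivity)]
      calc (2 : ℝ) ^ l k * |θ - x k| < 2 ^ l k * (1 / 2) ^ l k := by gcongr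
        _ = 1 := by rw [← mul_pow]; norm_num
    have hθ0 : (0 : ℝ) ≤ 2 ^ l k * θ := mul_nonneg (by positivity) (hD hθ)
    have hx0 : (0 : ℝ) ≤ 2 ^ l k * x k := mul_nonneg (by positivity) (hD hxk.2)
    obtain ⟨hlo, hhi⟩ := abs_lt.1 hmul
    have hf1 : ⌊2 ^ l k * θ⌋₊ ≤ j k + 1 := by
      rw [← Nat.floor_add_one hx0]
      exact Nat.floor_le_floor (by linarith)
    have hf2 : j k ≤ ⌊2 ^ l k * θ⌋₊ + 1 := by
      rw [← Nat.floor_add_one hθ0]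
      exact Nat.floor_le_floor (by linarith)
    have hcases : ⌊2 ^ l k * θ⌋₊ = j k - 1 ∨ ⌊2 ^ l k * θ⌋₊ = j k ∨
        ⌊2 ^ l k * θ⌋₊ = j k + 1 := by omega
    have hκ : 1 ≤ κ k {(l k, ⌊2 ^ l k * θ⌋₊)} := by
      simp only [κ, Measure.add_apply]
      rcases hcases with h | h | h <;> rw [h] <;> simp
    calc w k ≤ (w k • κ k) {(l k, ⌊2 ^ l k * θ⌋₊)} := by
          rw [Measure.smul_apply, smul_eq_mul]
          exact le_mul_of_one_le_right' hκ
      _ ≤ _ := by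
          rw [Measure.sum_apply _ MeasurableSet.of_discrete]
          exact ENNReal.le_tsum k

lemma ae_frequently_lt_of_tendsto_lintegral_zero {Ω : Type*} [MeasurableSpace Ω] {μ : Measure Ω}
    {f : ℕ → Ω → ENNReal} (hf : ∀ n, Measurable (f n))
    (h : Tendsto (fun n => ∫⁻ ω, f n ω ∂μ) atTop (nhds 0)) :
    ∀ᵐ ω ∂μ, ∀ ε > 0, ∃ᶠ n in atTop, f n ω < ε := by
  have h0 : ∫⁻ ω, liminf (fun n => f n ω) atTop ∂μ = 0 := by
    rw [← nonpos_iff_eq_zero, ← h.liminf_eq]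
    exact lintegral_liminf_le hf
  rw [lintegral_eq_zero_iff (.liminf hf)] at h0
  filter_upwards [h0] with ω hω ε hε
  apply frequently_lt_of_liminf_lt
  · isBoundedDefault
  · rw [hω]; exact hε

lemma measurable_dyadicMass {Ω : Type*} [MeasurableSpace Ω] {Z : ℕ → Ω → ℝ}
    (hZ : ∀ i, Measurable (Z i)) (n : ℕ) (v : ℕ × ℕ) :
    Measurable fun ω => dyadicMass (fun i => Z i ω) n v :=
  Finset.measurable_sum _ fun i _ => hZ i

lemma measurable_dyadicDeviation {Ω : Type*} [MeasurableSpace Ω] {Z : ℕ → Ω → ℝ}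
    (hZ : ∀ i, Measurable (Z i)) (p a : ℝ) (n : ℕ) :
    Measurable fun ω => dyadicDeviation p a (fun i => Z i ω) n :=
  Finset.measurable_sum _ fun l _ => Finset.measurable_sum _ fun j _ =>
    (((measurable_dyadicMass hZ n (l, j)).sub_const _).pow_const 2).const_mul _

lemma dyadicDeviation_nonneg {p : ℝ} (hp : 0 ≤ p) (a : ℝ) (z : ℕ → ℝ) (n : ℕ) :
    0 ≤ dyadicDeviation p a z n :=
  Finset.sum_nonneg fun _ _ => Finset.sum_nonneg fun _ _ => by positivity

lemma lintegral_dyadicDeviation_le {Ω : Type*} [MeasurableSpace Ω] {μ : Measure Ω}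
    [IsProbabilityMeasure μ] {Z : ℕ → Ω → ℝ} (hZ : ∀ i, Measurable (Z i))
    (hZ01 : ∀ i ω, Z i ω ∈ Icc (0 : ℝ) 1) {p a b : ℝ} (hp0 : 0 < p) (hp1 : p < 1) (hb : 0 ≤ b)
    (n : ℕ)
    (hmean : ∀ l j, l ≤ n → j < 2 ^ l →
      ∫ ω, dyadicMass (fun i => Z i ω) n (l, j) ∂μ = a * 2 ^ (n - l))
    (hvar : ∀ l j, l ≤ n → j < 2 ^ l →
      variance (fun ω => dyadicMass (fun i => Z i ω) n (l, j)) μ ≤ b * 2 ^ (n - l)) :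
    ∫⁻ ω, ENNReal.ofReal (dyadicDeviation p a (fun i => Z i ω) n) ∂μ ≤
      ENNReal.ofReal (b * 2 ^ n * (p⁻¹ ^ (n + 1) / (p⁻¹ - 1))) := by
  have hq : 1 < p⁻¹ := (one_lt_inv₀ hp0).2 hp1
  have hLp : ∀ v, MemLp (fun ω => dyadicMass (fun i => Z i ω) n v) 2 μ := fun v =>
    memLp_finsetSum _ fun i _ => MemLp.of_bound (hZ i).aestronglyMeasurable 1 <|
      .of_forall fun ω => by
        rw [Real.norm_eq_abs, abs_of_nonneg (hZ01 i ω).1]; exact (hZ01 i ω).2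
  have hint : ∀ l j, Integrable (fun ω =>
      (p ^ l)⁻¹ * (dyadicMass (fun i => Z i ω) n (l, j) - a * 2 ^ (n - l)) ^ 2) μ := fun l j =>
    ((hLp (l, j)).sub (memLp_const _)).integrable_sq.const_mul _
  have hdev : Integrable (fun ω => dyadicDeviation p a (fun i => Z i ω) n) μ :=
    integrable_finsetSum _ fun l _ => integrable_finsetSum _ fun j _ => hint l j
  rw [← ofReal_integral_eq_lintegral_ofReal hdev
    (.of_forall fun ω => dyadicDeviation_nonneg hp0.le _ _ _)]
  apply ENNReal.ofReal_le_ofReal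
  unfold dyadicDeviation
  rw [integral_finsetSum _ fun l _ => integrable_finsetSum _ fun j _ => hint l j]
  calc _ ≤ ∑ l ∈ Finset.range (n + 1), b * 2 ^ n * p⁻¹ ^ l := by
        apply Finset.sum_le_sum
        intro l hl
        have hln : l ≤ n := by simpa [Nat.lt_succ_iff] using hl
        rw [integral_finsetSum _ fun j _ => hint l j]
        calc _ ≤ ∑ j ∈ Finset.range (2 ^ l), (p ^ l)⁻¹ * (b * 2 ^ (n - l)) := by
              apply Finset.sum_le_sum
              intro j hj
              rw [Finset.mem_range] at hj
              have hv := hvar l j hln hj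
              rw [variance_eq_integral (hLp (l, j)).aemeasurable, hmean l j hln hj] at hv
              rw [integral_const_mul]
              gcongr
          _ = b * (2 ^ l * 2 ^ (n - l)) * p⁻¹ ^ l := by
              rw [Finset.sum_const, Finset.card_range, nsmul_eq_mul, inv_pow]
              push_cast
              ring
          _ = _ := by rw [← pow_add, Nat.add_sub_cancel' hln]
    _ = b * 2 ^ n * ((p⁻¹ ^ (n + 1) - 1) / (p⁻¹ - 1)) := by
        rw [← Finset.mul_sum, geom_sum_eq hq.ne']
    _ ≤ _ := by
        have : 0 < p⁻¹ - 1 := by linarith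
        gcongr
        linarith

/-- lower bound on the dimension of a limsup fractal on the binary tree. -/
theorem statement10
    {Ω : Type*} [MeasureSpace Ω] [IsProbabilityMeasure (ℙ : Measure Ω)]
    (Z : ℕ → ℕ → Ω → ℝ) (hZmeas : ∀ n i, Measurable (Z n i))
    (hZ01 : ∀ n i ω, Z n i ω ∈ Set.Icc (0 : ℝ) 1)
    (hZident : ∀ n i, i < 2 ^ n → IdentDistrib (Z n i) (Z n 0) ℙ ℙ)
    (hm : ∀ n : ℕ, 0 < ∫ ω, Z n 0 ω ∂ℙ)
    (ζ : ℕ → ℝ) (hζ : ∀ n, 1 ≤ ζ n)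
    (γ : ℝ) (hγ0 : 0 < γ) (hγ1 : γ < 1)
    (hmean : ∀ m n j : ℕ, m ≤ n → j < 2 ^ m →
      (∫ ω, (∑ i ∈ Finset.Ico (j * 2 ^ (n - m)) ((j + 1) * 2 ^ (n - m)), Z n i ω) ∂ℙ)
        = (∫ ω, Z n 0 ω ∂ℙ) * 2 ^ (n - m))
    (hvar : ∀ m n j : ℕ, m ≤ n → j < 2 ^ m →
      variance (fun ω => ∑ i ∈ Finset.Ico (j * 2 ^ (n - m)) ((j + 1) * 2 ^ (n - m)), Z n i ω) ℙ
        ≤ ζ n * (∫ ω, Z n 0 ω ∂ℙ) * 2 ^ (n - m))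
    (hlim : Filter.Tendsto
      (fun n : ℕ => 2 ^ ((n : ℝ) * (γ - 1)) * ζ n / ∫ ω, Z n 0 ω ∂ℙ)
      Filter.atTop (nhds 0)) :
    ∀ᵐ ω ∂ℙ, ENNReal.ofReal γ ≤
      dimH {θ : ℝ | θ ∈ Set.Ico (0 : ℝ) 1 ∧
        ∃ᶠ n : ℕ in atTop, 0 < Z n ⌊2 ^ n * θ⌋₊ ω} := by
  set p : ℝ := 2 ^ (-γ) with hpdef
  have hp0 : 0 < p := by positivity
  have hp1 : p < 1 := Real.rpow_lt_one_of_one_lt_of_neg (by norm_num) (by linarith)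
  have hp : 1 / 2 < p := by
    have : (2 : ℝ) ^ (-1 : ℝ) < 2 ^ (-γ) :=
      Real.rpow_lt_rpow_of_exponent_lt (by norm_num) (by linarith)
    rwa [Real.rpow_neg_one, ← one_div] at this
  have hq : 1 < p⁻¹ := (one_lt_inv₀ hp0).2 hp1
  set a : ℕ → ℝ := fun n => ∫ ω, Z n 0 ω ∂ℙ with ha
  have ha0 : ∀ n, 0 < a n := hm
  let f : ℕ → Ω → ENNReal := fun n ω =>
    ENNReal.ofReal (dyadicDeviation p (a n) (fun i => Z n i ω) n) /
      ENNReal.ofReal ((a n * 2 ^ n) ^ 2)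
  have hfm : ∀ n, Measurable (f n) := fun n =>
    (measurable_dyadicDeviation (hZmeas n) p (a n) n).ennreal_ofReal.div_const _
  have hft : Tendsto (fun n => ∫⁻ ω, f n ω ∂ℙ) atTop (nhds 0) := by
    have hlim' : Tendsto (fun n : ℕ => ENNReal.ofReal
        (p⁻¹ / (p⁻¹ - 1) * (2 ^ ((n : ℝ) * (γ - 1)) * ζ n / a n))) atTop (nhds 0) := by
      simpa using ENNReal.tendsto_ofReal (hlim.const_mul (p⁻¹ / (p⁻¹ - 1)))
    refine tendsto_of_tendsto_of_tendsto_of_le_of_le tendsto_const_nhds hlim'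
      (fun _ => zero_le) fun n => ?_
    have han := ha0 n
    have hle := lintegral_dyadicDeviation_le (μ := (ℙ : Measure Ω)) (hZmeas n) (hZ01 n) hp0 hp1
      (b := ζ n * a n) (by have := hζ n; positivity) n (fun l j hl hj => hmean l n j hl hj)
      (fun l j hl hj => hvar l n j hl hj)
    have hpow : (2 : ℝ) ^ ((n : ℝ) * (γ - 1)) = p⁻¹ ^ n / 2 ^ n := by
      rw [hpdef, ← Real.rpow_neg (by norm_num), neg_neg, ← Real.rpow_natCast (2 ^ γ),
        ← Real.rpow_mul (by norm_num), ← Real.rpow_natCast 2 n, ← Real.rpow_sub (by norm_num)]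
      congr 1; ring
    simp only [f, div_eq_mul_inv (ENNReal.ofReal _)]
    rw [lintegral_mul_const' _ _ (by simpa using by positivity), ← div_eq_mul_inv]
    refine (ENNReal.div_le_div_right hle _).trans_eq ?_
    rw [← ENNReal.ofReal_div_of_pos (by positivity), hpow]
    congr 1
    have : p⁻¹ - 1 ≠ 0 := by linarith
    have : p ≠ 0 := hp0.ne'
    rw [pow_succ]
    field_simp
  filter_upwards [ae_frequently_lt_of_tendsto_lintegral_zero hfm hft] with ω hω
  have hQ : ∀ η > 0, ∃ᶠ n in atTop,
      dyadicDeviation p (a n) (fun i => Z n i ω) n ≤ (η * (a n * 2 ^ n)) ^ 2 := fun η hη => by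
    refine (hω (ENNReal.ofReal (η ^ 2)) (by simpa using by positivity)).mono fun n hn => ?_
    have han := ha0 n
    simp only [f] at hn
    rw [← ENNReal.ofReal_div_of_pos (by positivity),
      ENNReal.ofReal_lt_ofReal_iff (by positivity), div_lt_iff₀ (by positivity)] at hn
    rw [mul_pow]
    exact hn.le
  lift γ to NNReal using hγ0.le
  rw [ENNReal.ofReal_coe_nnreal]
  apply le_dimH_of_hausdorffMeasure_ne_zero
  intro hzero
  obtain ⟨ν, hν1, hν2⟩ := exists_dyadic_cover hγ0 hγ1 (fun θ hθ => hθ.1.1) hzero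
  obtain ⟨θ, hθ, hfreq, hlt⟩ := exists_limsup_point hp hp1 ha0 (z := fun n i => Z n i ω)
    (fun n i => (hZ01 n i ω).1) hQ ν hν1
  obtain ⟨l, hl⟩ := hν2 θ ⟨hθ, hfreq⟩
  exact absurd hl (hlt l).not_ge
end
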